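/- arXiv:2405.07955 — 3 statements merged into one kernel-verified Lean document; each statement's English description precedes it below -/
import Mathlib

section
/- Let s := 1 + Y*X + X*Y in the algebra B. The element s commutes with every element of B (equivalently, s lies in the center of B), and consequently its two-sided inverse S' also lies in the center of B. (This is the first step in the proof of the Proposition 'center of the Beilinson quiver algebra': the relations imply that s commutes with all paths.) -/
/-!
Statement 0: In the Beilinson quiver algebra `B`, the element
`s = 1 + Y*X + X*Y` is central, and hence its two-sided inverse `S'`
is central as well.
-/

open FreeAlgebra in
/-- The defining relations of the Beilinson quiver algebra `B`, on the five
generators `E₁ = ι 0`, `E₂ = ι 1`, `X = ι 2`, `Y = ι 3`, `S' = ι 4`. -/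
inductive BRel : FreeAlgebra ℤ (Fin 5) → FreeAlgebra ℤ (Fin 5) → Prop
  | unit : BRel (ι ℤ (0 : Fin 5) + ι ℤ 1) 1
  | idem₁ : BRel (ι ℤ (0 : Fin 5) * ι ℤ 0) (ι ℤ 0)
  | idem₂ : BRel (ι ℤ (1 : Fin 5) * ι ℤ 1) (ι ℤ 1)
  | orth₁₂ : BRel (ι ℤ (0 : Fin 5) * ι ℤ 1) 0
  | orth₂₁ : BRel (ι ℤ (1 : Fin 5) * ι ℤ 0) 0
  | e₂x : BRel (ι ℤ (1 : Fin 5) * ι ℤ 2) (ι ℤ 2)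
  | xe₁ : BRel (ι ℤ (2 : Fin 5) * ι ℤ 0) (ι ℤ 2)
  | e₁y : BRel (ι ℤ (0 : Fin 5) * ι ℤ 3) (ι ℤ 3)
  | ye₂ : BRel (ι ℤ (3 : Fin 5) * ι ℤ 1) (ι ℤ 3)
  | sInvLeft : BRel (ι ℤ (4 : Fin 5) * (1 + ι ℤ 3 * ι ℤ 2 + ι ℤ 2 * ι ℤ 3)) 1
  | sInvRight : BRel ((1 + ι ℤ (3 : Fin 5) * ι ℤ 2 + ι ℤ 2 * ι ℤ 3) * ι ℤ 4) 1

/-- The Beilinson quiver algebra `B`: the free `ℤ`-algebra on `E₁, E₂, X, Y, S'`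
modulo the defining relations. -/
abbrev B := RingQuot BRel

/-- The quotient map from the free algebra to `B`. -/
noncomputable def mkB : FreeAlgebra ℤ (Fin 5) →ₐ[ℤ] B := RingQuot.mkAlgHom ℤ BRel

noncomputable def E₁ : B := mkB (FreeAlgebra.ι ℤ 0)
noncomputable def E₂ : B := mkB (FreeAlgebra.ι ℤ 1)
noncomputable def Xg : B := mkB (FreeAlgebra.ι ℤ 2)
noncomputable def Yg : B := mkB (FreeAlgebra.ι ℤ 3)
noncomputable def S' : B := mkB (FreeAlgebra.ι ℤ 4)

/-- `s = 1 + Y*X + X*Y`. -/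
noncomputable def sB : B := 1 + Yg * Xg + Xg * Yg

/-- Each defining relation of `B` holds in `B`. -/
theorem mkB_rel {a b : FreeAlgebra ℤ (Fin 5)} (h : BRel a b) : mkB a = mkB b :=
  RingQuot.mkAlgHom_rel ℤ h

theorem E₁_add_E₂ : E₁ + E₂ = 1 := by
  simpa [E₁, E₂] using mkB_rel BRel.unit

theorem E₁_mul_E₂ : E₁ * E₂ = 0 := by
  simpa [E₁, E₂] using mkB_rel BRel.orth₁₂

theorem E₂_mul_E₁ : E₂ * E₁ = 0 := by
  simpa [E₁, E₂] using mkB_rel BRel.orth₂₁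

theorem E₂_mul_Xg : E₂ * Xg = Xg := by
  simpa [E₂, Xg] using mkB_rel BRel.e₂x

theorem Xg_mul_E₁ : Xg * E₁ = Xg := by
  simpa [E₁, Xg] using mkB_rel BRel.xe₁

theorem E₁_mul_Yg : E₁ * Yg = Yg := by
  simpa [E₁, Yg] using mkB_rel BRel.e₁y

theorem Yg_mul_E₂ : Yg * E₂ = Yg := by
  simpa [E₂, Yg] using mkB_rel BRel.ye₂

theorem S'_mul_sB : S' * sB = 1 := by
  simpa [S', sB, Xg, Yg] using mkB_rel BRel.sInvLeft

theorem sB_mul_S' : sB * S' = 1 := by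
  simpa [S', sB, Xg, Yg] using mkB_rel BRel.sInvRight

theorem E₁_mul_Xg : E₁ * Xg = 0 := by
  rw [← E₂_mul_Xg, ← mul_assoc, E₁_mul_E₂, zero_mul]

theorem Yg_mul_E₁ : Yg * E₁ = 0 := by
  rw [← Yg_mul_E₂, mul_assoc, E₂_mul_E₁, mul_zero]

theorem Xg_mul_Xg : Xg * Xg = 0 := by
  nth_rw 1 [← Xg_mul_E₁]
  rw [mul_assoc, E₁_mul_Xg, mul_zero]

theorem Yg_mul_Yg : Yg * Yg = 0 := by
  nth_rw 2 [← E₁_mul_Yg]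
  rw [← mul_assoc, Yg_mul_E₁, zero_mul]

theorem commute_sB_E₁ : Commute sB E₁ := by
  have h : sB * E₁ = E₁ + Yg * Xg := by
    simp only [sB, add_mul, one_mul, mul_assoc, Xg_mul_E₁, Yg_mul_E₁, mul_zero, add_zero]
  have h' : E₁ * sB = E₁ + Yg * Xg := by
    simp only [sB, mul_add, mul_one, ← mul_assoc, E₁_mul_Xg, E₁_mul_Yg, zero_mul, add_zero]
  exact h.trans h'.symm

theorem commute_sB_E₂ : Commute sB E₂ := by
  rw [eq_sub_of_add_eq' E₁_add_E₂]
  exact (Commute.one_right sB).sub_right commute_sB_E₁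

theorem commute_sB_Xg : Commute sB Xg := by
  have h : sB * Xg = Xg + Xg * Yg * Xg := by
    simp only [sB, add_mul, one_mul, mul_assoc, Xg_mul_Xg, mul_zero, add_zero]
  have h' : Xg * sB = Xg + Xg * Yg * Xg := by
    simp only [sB, mul_add, mul_one, ← mul_assoc, Xg_mul_Xg, zero_mul, add_zero]
  exact h.trans h'.symm

theorem commute_sB_Yg : Commute sB Yg := by
  have h : sB * Yg = Yg + Yg * Xg * Yg := by
    simp only [sB, add_mul, one_mul, mul_assoc, Yg_mul_Yg, mul_zero, add_zero]
  have h' : Yg * sB = Yg + Yg * Xg * Yg := by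
    simp only [sB, mul_add, mul_one, ← mul_assoc, Yg_mul_Yg, zero_mul, add_zero]
  exact h.trans h'.symm

theorem commute_sB_S' : Commute sB S' :=
  sB_mul_S'.trans S'_mul_sB.symm

theorem commute_sB (b : B) : Commute sB b := by
  obtain ⟨a, rfl⟩ : ∃ a, mkB a = b := RingQuot.mkAlgHom_surjective ℤ BRel b
  induction a using FreeAlgebra.induction with
  | grade0 n =>
    rw [AlgHom.commutes]
    exact Algebra.commute_algebraMap_right n sB
  | grade1 i =>
    fin_cases i
    exacts [commute_sB_E₁, commute_sB_E₂, commute_sB_Xg, commute_sB_Yg, commute_sB_S']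
  | mul a b ha hb =>
    rw [map_mul]
    exact ha.mul_right hb
  | add a b ha hb =>
    rw [map_add]
    exact ha.add_right hb

theorem commute_S' (b : B) : Commute S' b :=
  (commute_sB b).units_inv_left (u := ⟨sB, S', sB_mul_S', S'_mul_sB⟩)

theorem s_central_and_S'_central :
    (∀ b : B, sB * b = b * sB) ∧ sB ∈ Subalgebra.center ℤ B ∧
      S' ∈ Subalgebra.center ℤ B :=
  ⟨commute_sB, Subalgebra.mem_center_iff.2 fun b => (commute_sB b).symm,
    Subalgebra.mem_center_iff.2 fun b => (commute_S' b).symm⟩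
end

section
/- For every real ε with 0 < ε < 1/2 there exist a constant c > 0 and functions P, Q : ℝ² → ℝ such that: (a) P and Q are C^∞ on ℝ² ∖ {0} (ContDiffOn ℝ ⊤ on the set {p | p ≠ 0}); (b) for every p = (x, y) with ‖p‖ ≥ 2 − ε one has P p = y and Q p = 0 (i.e. λ = y dx there, the standard cotangent Liouville form); (c) for every p = (x, y) with 0 < ‖p‖ ≤ 1 + ε one has P p = c * (Real.log ‖p‖) * y / ‖p‖² and Q p = − c * (Real.log ‖p‖) * x / ‖p‖² (i.e. λ = c·ρ dθ there, with ρ = −log r); (d) P and Q are differentiable at every p ≠ 0 and fderiv ℝ P p (0,1) − fderiv ℝ Q p (1,0) > 0 for every p ≠ 0, i.e. the 2-form ω = −dλ = (∂P/∂y − ∂Q/∂x) dx∧dy is nowhere vanishing on ℝ² ∖ {0}. (This is the existence-of-Liouville-structure content of the Proposition on the punctured plane T*ℝ ∖ T*{0}: the 1-form λ = P dx + Q dy interpolates between λ₀ = y dx near infinity and c·λ₁ = c·ρ dθ near the puncture, and −dλ is a symplectic form.) -/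
/-!
Statement 5: existence of a Liouville one-form `λ = P dx + Q dy` on the
punctured plane `T*ℝ ∖ T*₀ℝ = ℝ² ∖ {0}` interpolating between the standard
cotangent form `y dx` near infinity and `c·ρ dθ` (with `ρ = -log r`) near the
puncture, whose negative differential `ω = (∂P/∂y - ∂Q/∂x) dx∧dy` is nowhere
vanishing (indeed positive) on `ℝ² ∖ {0}`.
-/

/-- The plane `ℝ²` with its Euclidean norm, modelling `T*ℝ`. -/
abbrev Plane := EuclideanSpace ℝ (Fin 2)

/-- The tangent vector `(1, 0)` (the `x`-direction). -/
noncomputable def ex : Plane := EuclideanSpace.single 0 1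

/-- The tangent vector `(0, 1)` (the `y`-direction). -/
noncomputable def ey : Plane := EuclideanSpace.single 1 1

/-- A smooth monotone cutoff, equal to `0` left of `a` and to `1` right of `b`. -/
theorem exists_contDiff_monotone_cutoff {a b : ℝ} (hab : a < b) :
    ∃ χ : ℝ → ℝ, ContDiff ℝ (⊤ : ℕ∞) χ ∧ Monotone χ ∧ (∀ s, 0 ≤ χ s) ∧ (∀ s, χ s ≤ 1) ∧
      (∀ s ≤ a, χ s = 0) ∧ ∀ s, b ≤ s → χ s = 1 := by
  have hb : 0 < b - a := sub_pos.2 hab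
  refine ⟨fun s => Real.smoothTransition ((s - a) / (b - a)), ?_, ?_,
    fun s => Real.smoothTransition.nonneg _, fun s => Real.smoothTransition.le_one _,
    fun s hs => Real.smoothTransition.zero_of_nonpos ?_,
    fun s hs => Real.smoothTransition.one_of_one_le ?_⟩
  · exact Real.smoothTransition.contDiff.comp
      ((contDiff_id.sub contDiff_const).div_const _)
  · intro s t hst
    apply Real.smoothTransition.monotone
    gcongr
  · exact div_nonpos_of_nonpos_of_nonneg (by linarith) hb.le
  · rw [one_le_div hb]; linarith

theorem fderiv_apply_eq_of_hasDerivAt {E : Type*} [NormedAddCommGroup E] [NormedSpace ℝ E]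
    {f : E → ℝ} {p v : E} {f' : ℝ} (hf : DifferentiableAt ℝ f p)
    (h : HasDerivAt (fun t : ℝ => f (p + t • v)) f' 0) : fderiv ℝ f p v = f' := by
  rw [← hf.lineDeriv_eq_fderiv]
  exact HasLineDerivAt.lineDeriv h

/-- The `dx`-coefficient of `(1 - χ) (-log r dθ) + χ y dx + (x y / 2) dχ`, where `χ` is
evaluated at `r ^ 2`. -/
noncomputable def liouvilleP (χ : ℝ → ℝ) (x y : ℝ) : ℝ :=
  (1 - χ (x ^ 2 + y ^ 2)) * (Real.log (x ^ 2 + y ^ 2) / 2) * y / (x ^ 2 + y ^ 2)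
    + χ (x ^ 2 + y ^ 2) * y + deriv χ (x ^ 2 + y ^ 2) * (x ^ 2 * y)

/-- The `dy`-coefficient of `(1 - χ) (-log r dθ) + χ y dx + (x y / 2) dχ`, where `χ` is
evaluated at `r ^ 2`. -/
noncomputable def liouvilleQ (χ : ℝ → ℝ) (x y : ℝ) : ℝ :=
  -((1 - χ (x ^ 2 + y ^ 2)) * (Real.log (x ^ 2 + y ^ 2) / 2) * x / (x ^ 2 + y ^ 2))
    + deriv χ (x ^ 2 + y ^ 2) * (x * y ^ 2)

theorem exists_hasDerivAt_liouville {χ : ℝ → ℝ} (hχ : ContDiff ℝ (⊤ : ℕ∞) χ) {x y : ℝ}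
    (hs : 0 < x ^ 2 + y ^ 2) :
    ∃ P' Q' : ℝ, HasDerivAt (fun t => liouvilleP χ x (y + t)) P' 0 ∧
      HasDerivAt (fun t => liouvilleQ χ (x + t) y) Q' 0 ∧
      P' - Q' = (1 - χ (x ^ 2 + y ^ 2)) / (x ^ 2 + y ^ 2) + χ (x ^ 2 + y ^ 2)
        + deriv χ (x ^ 2 + y ^ 2) * (x ^ 2 + y ^ 2 - Real.log (x ^ 2 + y ^ 2)) := by
  have hd : ContDiff ℝ (⊤ : ℕ∞) (deriv χ) := (contDiff_infty_iff_deriv.1 hχ).2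
  have h1 : HasDerivAt χ (deriv χ (x ^ 2 + y ^ 2)) (x ^ 2 + y ^ 2) :=
    (hχ.differentiable (by simp) _).hasDerivAt
  have h2 : HasDerivAt (deriv χ) (deriv (deriv χ) (x ^ 2 + y ^ 2)) (x ^ 2 + y ^ 2) :=
    (hd.differentiable (by simp) _).hasDerivAt
  have h3 := Real.hasDerivAt_log hs.ne'
  have hy : HasDerivAt (fun t : ℝ => y + t) 1 0 := (hasDerivAt_id' _).const_add y
  have hx : HasDerivAt (fun t : ℝ => x + t) 1 0 := (hasDerivAt_id' _).const_add x
  have sy : HasDerivAt (fun t : ℝ => x ^ 2 + (y + t) ^ 2) (2 * y) 0 := by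
    simpa using (hy.pow 2).const_add (x ^ 2)
  have sx : HasDerivAt (fun t : ℝ => (x + t) ^ 2 + y ^ 2) (2 * x) 0 := by
    simpa using (hx.pow 2).add_const (y ^ 2)
  have ey0 : x ^ 2 + y ^ 2 = x ^ 2 + (y + 0) ^ 2 := by simp
  have ex0 : x ^ 2 + y ^ 2 = (x + 0) ^ 2 + y ^ 2 := by simp
  have y1 := h1.comp_of_eq (0 : ℝ) sy ey0
  have y2 := h2.comp_of_eq (0 : ℝ) sy ey0
  have y3 := h3.comp_of_eq (0 : ℝ) sy ey0
  have x1 := h1.comp_of_eq (0 : ℝ) sx ex0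
  have x2 := h2.comp_of_eq (0 : ℝ) sx ex0
  have x3 := h3.comp_of_eq (0 : ℝ) sx ex0
  refine ⟨_, _, (((((y1.const_sub 1).mul (y3.div_const 2)).mul hy).div sy
      (ey0 ▸ hs.ne')).add (y1.mul hy)).add (y2.mul (hy.const_mul (x ^ 2))),
    (((((x1.const_sub 1).mul (x3.div_const 2)).mul hx).div sx
      (ex0 ▸ hs.ne')).neg).add (x2.mul (hx.mul_const (y ^ 2))), ?_⟩
  simp only [Function.comp_apply, add_zero, Pi.mul_apply]
  field_simp
  ring

theorem Plane.norm_sq_eq (p : Plane) : ‖p‖ ^ 2 = p 0 ^ 2 + p 1 ^ 2 := by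
  simp [EuclideanSpace.real_norm_sq_eq]

theorem Plane.sq_add_sq_pos {p : Plane} (hp : p ≠ 0) : 0 < p 0 ^ 2 + p 1 ^ 2 := by
  rw [← Plane.norm_sq_eq]
  exact pow_pos (norm_pos_iff.2 hp) 2

theorem contDiffAt_liouville {χ : ℝ → ℝ} (hχ : ContDiff ℝ (⊤ : ℕ∞) χ) {p : Plane}
    (hp : p ≠ 0) :
    ContDiffAt ℝ (⊤ : ℕ∞) (fun p : Plane => liouvilleP χ (p 0) (p 1)) p ∧
      ContDiffAt ℝ (⊤ : ℕ∞) (fun p : Plane => liouvilleQ χ (p 0) (p 1)) p := by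
  have hd : ContDiff ℝ (⊤ : ℕ∞) (deriv χ) := (contDiff_infty_iff_deriv.1 hχ).2
  have hs := (Plane.sq_add_sq_pos hp).ne'
  have hx : ContDiffAt ℝ (⊤ : ℕ∞) (fun p : Plane => p 0) p := by fun_prop
  have hy : ContDiffAt ℝ (⊤ : ℕ∞) (fun p : Plane => p 1) p := by fun_prop
  have h0 := (hx.pow 2).add (hy.pow 2)
  have h1 := hχ.contDiffAt.comp p h0
  have h2 := hd.contDiffAt.comp p h0
  have h3 := h0.log hs
  have h4 := (contDiffAt_const (c := (1 : ℝ))).sub h1 |>.mul (h3.div_const 2)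
  exact ⟨(((h4.mul hy).div h0 hs).add (h1.mul hy)).add (h2.mul ((hx.pow 2).mul hy)),
    ((h4.mul hx).div h0 hs).neg.add (h2.mul (hx.mul (hy.pow 2)))⟩

theorem liouville_structure_on_punctured_plane :
    ∀ ε : ℝ, 0 < ε → ε < 1 / 2 →
      ∃ c : ℝ, 0 < c ∧ ∃ P Q : Plane → ℝ,
        -- (a) smoothness away from the puncture
        ContDiffOn ℝ (⊤ : ℕ∞) P {p : Plane | p ≠ 0} ∧
        ContDiffOn ℝ (⊤ : ℕ∞) Q {p : Plane | p ≠ 0} ∧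
        -- (b) λ = y dx for ‖p‖ ≥ 2 - ε
        (∀ p : Plane, 2 - ε ≤ ‖p‖ → P p = p 1 ∧ Q p = 0) ∧
        -- (c) λ = c · (-log r) dθ for 0 < ‖p‖ ≤ 1 + ε
        (∀ p : Plane, p ≠ 0 → ‖p‖ ≤ 1 + ε →
          P p = c * Real.log ‖p‖ * p 1 / ‖p‖ ^ 2 ∧
          Q p = -(c * Real.log ‖p‖ * p 0) / ‖p‖ ^ 2) ∧
        -- (d) ω = -dλ = (∂P/∂y - ∂Q/∂x) dx∧dy is everywhere positive on ℝ² ∖ {0}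
        (∀ p : Plane, p ≠ 0 →
          DifferentiableAt ℝ P p ∧ DifferentiableAt ℝ Q p ∧
          0 < fderiv ℝ P p ey - fderiv ℝ Q p ex) := by
  intro ε hε hε'
  obtain ⟨χ, hχ, hmono, hnonneg, hle, hzero, hone⟩ :=
    exists_contDiff_monotone_cutoff (a := (1 + ε) ^ 2) (b := (2 - ε) ^ 2) (by nlinarith)
  refine ⟨1, one_pos, fun p => liouvilleP χ (p 0) (p 1), fun p => liouvilleQ χ (p 0) (p 1),
    fun p hp => (contDiffAt_liouville hχ hp).1.contDiffWithinAt,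
    fun p hp => (contDiffAt_liouville hχ hp).2.contDiffWithinAt, ?_, ?_, ?_⟩
  · intro p hp
    have h1 : χ (p 0 ^ 2 + p 1 ^ 2) = 1 := by
      apply hone
      rw [← Plane.norm_sq_eq]
      gcongr
      linarith
    have h2 : deriv χ (p 0 ^ 2 + p 1 ^ 2) = 0 :=
      IsLocalMax.deriv_eq_zero (Filter.Eventually.of_forall fun s => h1 ▸ hle s)
    simp [liouvilleP, liouvilleQ, h1, h2]
  · intro p hp hp'
    have h1 : χ (p 0 ^ 2 + p 1 ^ 2) = 0 := by
      apply hzero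
      rw [← Plane.norm_sq_eq]
      gcongr
    have h2 : deriv χ (p 0 ^ 2 + p 1 ^ 2) = 0 :=
      IsLocalMin.deriv_eq_zero (Filter.Eventually.of_forall fun s => h1 ▸ hnonneg s)
    have h3 : Real.log (p 0 ^ 2 + p 1 ^ 2) / 2 = Real.log ‖p‖ := by
      rw [← Plane.norm_sq_eq, Real.log_pow]
      simp
    simp [liouvilleP, liouvilleQ, h1, h2, h3, Plane.norm_sq_eq, neg_div]
  · intro p hp
    have hs := Plane.sq_add_sq_pos hp
    have hP := (contDiffAt_liouville hχ hp).1.differentiableAt (by simp)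
    have hQ := (contDiffAt_liouville hχ hp).2.differentiableAt (by simp)
    refine ⟨hP, hQ, ?_⟩
    obtain ⟨P', Q', hP', hQ', heq⟩ := exists_hasDerivAt_liouville hχ hs
    rw [fderiv_apply_eq_of_hasDerivAt hP (v := ey) (f' := P') (by simpa [ey] using hP'),
      fderiv_apply_eq_of_hasDerivAt hQ (v := ex) (f' := Q') (by simpa [ex] using hQ'), heq]
    have hlog := Real.log_le_sub_one_of_pos hs
    have hderiv : 0 ≤ deriv χ (p 0 ^ 2 + p 1 ^ 2) := hmono.deriv_nonneg
    have h1 := mul_nonneg hderiv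
      (by linarith : 0 ≤ p 0 ^ 2 + p 1 ^ 2 - Real.log (p 0 ^ 2 + p 1 ^ 2))
    have h2 : 0 ≤ (1 - χ (p 0 ^ 2 + p 1 ^ 2)) / (p 0 ^ 2 + p 1 ^ 2) :=
      div_nonneg (sub_nonneg.2 (hle _)) hs.le
    rcases (hnonneg (p 0 ^ 2 + p 1 ^ 2)).eq_or_lt with h | h
    · rw [← h, sub_zero] at h2 ⊢
      have := one_div_pos.2 hs
      linarith
    · linarith
end

section
/- Let ε be a real number with 0 < ε < 1/2, and let η : ℝ → ℝ be a C^∞ function satisfying: η r = 0 for all r ≤ 1 + ε; η r = 1 for all r ≥ 2 − ε; 0 < η r < 1 and deriv η r > 0 for all r with 1 + ε < r < 2 − ε; and deriv η r ≥ 0 for all r. Then there exists c > 0 such that for every r > 0 and every θ ∈ ℝ, r * η r + (deriv η r) * r² * (Real.sin θ)² + c * deriv (fun u => (1 − η u) * Real.log u) r > 0. (This is the key estimate in the proof of the Proposition constructing the Liouville structure on the punctured cotangent bundle of ℝ: it shows that the interpolated form λ = η·λ₀ + c·(1−η)·λ₁ has ω = −dλ = F dr∧dθ with F > 0 everywhere,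 for c sufficiently small.) -/
/-!
Statement 6: the key positivity estimate for the interpolated Liouville form
`λ = η·λ₀ + c·(1-η)·λ₁` on the punctured plane: for a suitable constant
`c > 0`, the coefficient
`F(r, θ) = r·η(r) + η'(r)·r²·sin²θ + c·((1-η(r))·log r)'`
of `ω = -dλ = F dr∧dθ` is positive for all `r > 0` and all `θ`.
-/

/-- If `f ≥ 0` and `g` are continuous on a compact set and at every point one of them is positive,
then `f + c * g` is positive on that set for some `c > 0`. -/
theorem IsCompact.exists_pos_add_mul_pos {X : Type*} [TopologicalSpace X] {K : Set X}
    (hK : IsCompact K) {f g : X → ℝ} (hf : ContinuousOn f K) (hg : ContinuousOn g K)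
    (hf0 : ∀ x ∈ K, 0 ≤ f x) (h : ∀ x ∈ K, 0 < f x ∨ 0 < g x) :
    ∃ c : ℝ, 0 < c ∧ ∀ x ∈ K, 0 < f x + c * g x := by
  obtain ⟨M, hM⟩ := hK.exists_bound_of_continuousOn hg
  rcases K.eq_empty_or_nonempty with rfl | hne
  · exact ⟨1, one_pos, by simp⟩
  have hmax : ContinuousOn (fun x => max (f x) (g x)) K := hf.sup hg
  obtain ⟨x₀, hx₀, hmin⟩ := hK.exists_isMinOn hne hmax
  have hm : 0 < max (f x₀) (g x₀) := lt_max_iff.2 (h x₀ hx₀)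
  set m := max (f x₀) (g x₀)
  have hM0 : 0 ≤ M := (norm_nonneg _).trans (hM x₀ hx₀)
  have hM1 : 0 < M + 1 := by linarith
  have hc : 0 < m / (M + 1) := div_pos hm hM1
  refine ⟨m / (M + 1), hc, fun x hx => ?_⟩
  rcases lt_or_ge 0 (g x) with hgx | hgx
  · exact add_pos_of_nonneg_of_pos (hf0 x hx) (mul_pos hc hgx)
  · have hmx : m ≤ max (f x) (g x) := hmin hx
    have hfx : m ≤ f x := (le_max_iff.1 hmx).resolve_right (by linarith)
    have hgM : -M ≤ g x := (abs_le.1 (hM x hx)).1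
    have hcm : m / (M + 1) * (M + 1) = m := div_mul_cancel₀ m hM1.ne'
    nlinarith

theorem deriv_one_sub_mul_log {η : ℝ → ℝ} {r : ℝ} (hη : DifferentiableAt ℝ η r) (hr : r ≠ 0) :
    deriv (fun u : ℝ => (1 - η u) * Real.log u) r =
      -deriv η r * Real.log r + (1 - η r) * r⁻¹ :=
  ((hη.hasDerivAt.const_sub 1).mul (Real.hasDerivAt_log hr)).deriv

theorem interpolated_form_positive
    (ε : ℝ) (hε0 : 0 < ε) (hε : ε < 1 / 2)
    (η : ℝ → ℝ) (hsmooth : ContDiff ℝ (⊤ : ℕ∞) η)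
    (h0 : ∀ r : ℝ, r ≤ 1 + ε → η r = 0)
    (h1 : ∀ r : ℝ, 2 - ε ≤ r → η r = 1)
    (hmid : ∀ r : ℝ, 1 + ε < r → r < 2 - ε →
      0 < η r ∧ η r < 1 ∧ 0 < deriv η r)
    (hmono : ∀ r : ℝ, 0 ≤ deriv η r) :
    ∃ c : ℝ, 0 < c ∧ ∀ r : ℝ, 0 < r → ∀ θ : ℝ,
      0 < r * η r + deriv η r * r ^ 2 * Real.sin θ ^ 2 +
        c * deriv (fun u : ℝ => (1 - η u) * Real.log u) r := by
  have hd : Differentiable ℝ η := hsmooth.differentiable (by simp)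
  have hd' : Continuous (deriv η) := hsmooth.continuous_deriv (by exact_mod_cast le_top)
  have hη : Monotone η := monotone_of_deriv_nonneg hd hmono
  have hη0 (r : ℝ) : 0 ≤ η r := by
    rw [← h0 (min r 0) (by linarith [min_le_right r 0])]
    exact hη (min_le_left r 0)
  have hη1 (r : ℝ) : η r ≤ 1 := by
    rw [← h1 (max r 2) (by linarith [le_max_right r 2])]
    exact hη (le_max_left r 2)
  have hd0 (r : ℝ) (hr : r ≤ 1 + ε) : deriv η r = 0 :=
    IsLocalMin.deriv_eq_zero (Filter.Eventually.of_forall fun x => by rw [h0 r hr]; exact hη0 x)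
  have hd1 (r : ℝ) (hr : 2 - ε ≤ r) : deriv η r = 0 :=
    IsLocalMax.deriv_eq_zero (Filter.Eventually.of_forall fun x => by rw [h1 r hr]; exact hη1 x)
  obtain ⟨c, hc, hpos⟩ := (isCompact_Icc (a := (1 : ℝ)) (b := 2)).exists_pos_add_mul_pos
    (f := fun r => r * η r) (g := fun r => -deriv η r * Real.log r + (1 - η r) * r⁻¹)
    (continuous_id.mul hd.continuous).continuousOn
    (by
      have hne : ∀ r ∈ Set.Icc (1 : ℝ) 2, r ≠ 0 := fun r hr => (one_pos.trans_le hr.1).ne'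
      exact (hd'.neg.continuousOn.mul (continuousOn_id.log hne)).add
        ((continuous_const.sub hd.continuous).continuousOn.mul (continuousOn_id.inv₀ hne)))
    (fun r hr => mul_nonneg (zero_le_one.trans hr.1) (hη0 r))
    (fun r hr => by
      have hr0 : 0 < r := one_pos.trans_le hr.1
      rcases le_or_gt r (1 + ε) with h | h
      · right
        simpa [h0 r h, hd0 r h] using hr0
      · left
        refine mul_pos hr0 ?_
        rcases lt_or_ge r (2 - ε) with h' | h'
        · exact (hmid r h h').1
        · simp [h1 r h'])
  refine ⟨c, hc, fun r hr θ => ?_⟩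
  rw [deriv_one_sub_mul_log (hd r) hr.ne']
  have hsin : 0 ≤ deriv η r * r ^ 2 * Real.sin θ ^ 2 :=
    mul_nonneg (mul_nonneg (hmono r) (sq_nonneg r)) (sq_nonneg _)
  suffices 0 < r * η r + c * (-deriv η r * Real.log r + (1 - η r) * r⁻¹) by linarith
  rcases lt_or_ge r 1 with hlt | hge
  · have h : r ≤ 1 + ε := by linarith
    simpa [h0 r h, hd0 r h] using mul_pos hc (inv_pos.2 hr)
  rcases le_or_gt r 2 with hle | hgt
  · exact hpos r ⟨hge, hle⟩
  · have h : 2 - ε ≤ r := by linarith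
    simpa [h1 r h, hd1 r h] using hr
end
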